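/- Let p be a prime, M an abelian group with an external Frobenius φ, and n ≥ 1. Then for every x ∈ M^{⊗p^{n−1}}, the element φ_{n−1}(x) − x^{⊗p} of M^{⊗p^n} lies in the image of the transfer tr_e^{C_p} = Σ_{s=0}^{p−1} σ_n^{s·p^{n−1}} : M^{⊗p^n} → M^{⊗p^n} (the norm of the subgroup C_p ⊆ C_{p^n} generated by σ_n^{p^{n−1}}). -/

import Mathlib

open scoped TensorProduct

section Digits

/-- Identification of digit tuples `(Fin p)^m` (first digit most significant) with `Fin (p^m)`
via base-`p` digits. -/
def msbEquiv (p m : ℕ) : (Fin m → Fin p) ≃ Fin (p ^ m) :=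
  (Equiv.piCongrLeft' (fun _ => Fin p) Fin.revPerm).trans finFunctionFinEquiv

/-- The digit rotation `τ_m : (i_1, …, i_m) ↦ (i_m, i_1, …, i_{m-1})` of digit tuples. -/
def rotPerm (p m : ℕ) [NeZero m] : Equiv.Perm (Fin m → Fin p) :=
  Equiv.piCongrLeft' (fun _ => Fin p) (Equiv.addRight (1 : Fin m))

/-- The permutation of `Fin (p^m)` corresponding to a permutation of digit tuples. -/
def digitPerm (p m : ℕ) (e : Equiv.Perm (Fin m → Fin p)) : Equiv.Perm (Fin (p ^ m)) :=
  Equiv.permCongr (msbEquiv p m) e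

end Digits

noncomputable section Tensor

/-- The `m`-fold tensor power over `ℤ` of an abelian group `A`, indexed by `Fin m`. -/
abbrev Tp (A : Type*) [AddCommGroup A] (m : ℕ) : Type _ := ⨂[ℤ] _ : Fin m, A

/-- The action of a permutation `e` of `Fin m` on the tensor power, by reindexing. -/
def permT (A : Type*) [AddCommGroup A] (m : ℕ) (e : Equiv.Perm (Fin m)) :
    Tp A m ≃ₗ[ℤ] Tp A m :=
  PiTensorProduct.reindex ℤ (fun _ : Fin m => A) e

/-- The cyclic permutation `σ_m` on the tensor power, induced by reindexing along
`x ↦ x + 1` on `Fin m`, so that `σ(a_1 ⊗ ⋯ ⊗ a_m) = a_m ⊗ a_1 ⊗ ⋯ ⊗ a_{m-1}`. -/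
def sigmaT (A : Type*) [AddCommGroup A] (m : ℕ) [NeZero m] : Tp A m ≃ₗ[ℤ] Tp A m :=
  permT A m (Equiv.addRight (1 : Fin m))

/-- The norm (transfer) map `N_m = Σ_{s=0}^{m-1} σ_m^s` on the tensor power. -/
def normT (A : Type*) [AddCommGroup A] (m : ℕ) [NeZero m] : Tp A m → Tp A m :=
  fun x => ∑ s ∈ Finset.range m, (⇑(sigmaT A m))^[s] x

/-- Identification of tensor powers of equal sizes. -/
def tcast {A : Type*} [AddCommGroup A] {a b : ℕ} (h : a = b) : Tp A a ≃ₗ[ℤ] Tp A b :=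
  TensorPower.cast ℤ A h

/-- Flattening of an iterated tensor power: `(A^{⊗N})^{⊗q} ≃ A^{⊗(N·q)}`, grouping
consecutive blocks of length `N`. -/
def flattenE (A : Type*) [AddCommGroup A] (N : ℕ) : (q : ℕ) →
    (⨂[ℤ] _ : Fin q, Tp A N) ≃ₗ[ℤ] Tp A (N * q)
  | 0 => (PiTensorProduct.isEmptyEquiv (Fin 0)).trans
      (PiTensorProduct.isEmptyEquiv (Fin 0)).symm
  | q + 1 =>
      (TensorPower.mulEquiv (R := ℤ) (M := Tp A N) (n := q) (m := 1)).symm.trans <|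
      (TensorProduct.congr (flattenE A N q)
        (PiTensorProduct.subsingletonEquiv (0 : Fin 1))).trans <|
      TensorPower.mulEquiv (R := ℤ) (M := A) (n := N * q) (m := N)

/-- The elementary tensor `c^{⊗B} ∈ A^{⊗(N·B)}` whose `B` consecutive blocks of length `N`
all equal `c ∈ A^{⊗N}`. -/
def tpow {A : Type*} [AddCommGroup A] {N : ℕ} (c : Tp A N) (B : ℕ) : Tp A (N * B) :=
  flattenE A N B (PiTensorProduct.tprod ℤ (fun _ : Fin B => c))

/-- `c^{⊗B}`, recast to live in `A^{⊗m}` along an identification `N * B = m`. -/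
def tpowTo {A : Type*} [AddCommGroup A] {N : ℕ} (c : Tp A N) (B : ℕ) {m : ℕ}
    (h : N * B = m) : Tp A m :=
  tcast (A := A) h (tpow c B)

end Tensor

noncomputable section Frobenius

variable (p : ℕ) [NeZero p] {M : Type*} [AddCommGroup M]

/-- `φ^{⊗q}` : applies an additive map `φ : M → M^{⊗p}` to each of the `q` tensor factors,
the `p` outputs of each application of `φ` occupying a consecutive block of length `p`. -/
def frobT (φ : M →+ Tp M p) (q : ℕ) : Tp M q →ₗ[ℤ] Tp M (p * q) :=
  (flattenE M p q).toLinearMap ∘ₗ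
    PiTensorProduct.map (fun _ : Fin q => φ.toIntLinearMap)

/-- The higher Frobenius `φ_n : M^{⊗p^n} → M^{⊗p^{n+1}}`, the composite of `φ^{⊗p^n}`
(outputs of `φ` in the last base-`p` digit) followed by the action of the digit rotation
`τ_{n+1}`. -/
def higherFrob (φ : M →+ Tp M p) (n : ℕ) : Tp M (p ^ n) →ₗ[ℤ] Tp M (p ^ (n + 1)) :=
  (permT M (p ^ (n + 1)) (digitPerm p (n + 1) (rotPerm p (n + 1)))).toLinearMap ∘ₗ
    (tcast (A := M) (pow_succ' p n).symm).toLinearMap ∘ₗ frobT p φ (p ^ n)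

/-- An external Frobenius on an abelian group `M` (for the prime `p`): an additive map
`φ : M → M^{⊗p}` landing in the `σ_1`-invariants and congruent to `m ↦ m^{⊗p}` modulo the
image of the norm map `N_p = Σ_{s=0}^{p-1} σ_1^s`. -/
structure ExternalFrobenius (M : Type*) [AddCommGroup M] : Type _ where
  toFun : M →+ Tp M p
  fixed : ∀ m : M, sigmaT M p (toFun m) = toFun m
  congr_pow : ∀ m : M,
    toFun m - PiTensorProduct.tprod ℤ (fun _ : Fin p => m) ∈ Set.range (normT M p)

end Frobenius

section Norm

open Finset Function

/-- The norm `Σ_{s < p} S^s` of an endomorphism `S`. -/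
def endNorm {W : Type*} [AddCommGroup W] (S : Module.End ℤ W) (p : ℕ) : Module.End ℤ W :=
  ∑ s ∈ range p, S ^ s

theorem endNorm_apply {W : Type*} [AddCommGroup W] (S : Module.End ℤ W) (p : ℕ) (y : W) :
    endNorm S p y = ∑ s ∈ range p, S^[s] y := by
  simp [endNorm, LinearMap.sum_apply, Module.End.pow_apply]

/-- The sum of an equivariant family over a finite set on which a permutation of prime order `p`
acts without fixed points is a norm. -/
theorem sum_mem_range_endNorm {X W : Type*} [DecidableEq X] [AddCommGroup W]
    (S : Module.End ℤ W) {p : ℕ} (hp : p.Prime) (σ : X → X) (hσ : ∀ x, σ^[p] x = x)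
    (h : X → W) (hS : ∀ x, S (h x) = h (σ x)) (F : Finset X)
    (hF : ∀ x, σ x ∈ F ↔ x ∈ F) (hfix : ∀ x ∈ F, σ x ≠ x) :
    ∑ x ∈ F, h x ∈ LinearMap.range (endNorm S p) := by
  have : Fact p.Prime := ⟨hp⟩
  have hit : ∀ s x, S^[s] (h x) = h (σ^[s] x) := by
    intro s x
    induction s generalizing x with
    | zero => rfl
    | succ s ih => rw [iterate_succ_apply, iterate_succ_apply, hS, ih]
  induction F using Finset.strongInduction with
  | H F ih =>
  rcases F.eq_empty_or_nonempty with rfl | ⟨x, hx⟩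
  · simp
  have hmin : minimalPeriod σ x = p := minimalPeriod_eq_prime (hσ x) (hfix x hx)
  have hinj : Set.InjOn (fun s => σ^[s] x) (range p : Set ℕ) := by
    have := iterate_injOn_Iio_minimalPeriod (f := σ) (x := x)
    rw [hmin] at this
    simpa using this
  set O := (range p).image (fun s => σ^[s] x) with hO
  have hmemO : ∀ s, σ^[s] x ∈ O := fun s =>
    mem_image.2 ⟨s % p, by simp [Nat.mod_lt _ hp.pos], by
      simpa [hmin] using iterate_mod_minimalPeriod_eq (f := σ) (x := x) (n := s)⟩
  have hOF : O ⊆ F := by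
    intro y hy
    obtain ⟨s, -, rfl⟩ := mem_image.1 hy
    induction s with
    | zero => exact hx
    | succ s ihs =>
      simp only [iterate_succ_apply']
      exact (hF _).2 (ihs (hmemO s))
  have hσO : ∀ y, σ y ∈ O ↔ y ∈ O := by
    have hfwd : ∀ y ∈ O, σ y ∈ O := by
      intro y hy
      obtain ⟨s, -, rfl⟩ := mem_image.1 hy
      simpa only [iterate_succ_apply'] using hmemO (s + 1)
    refine fun y => ⟨fun hy => ?_, hfwd y⟩
    have hk : ∀ k, σ^[k] (σ y) ∈ O := by
      intro k
      induction k with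
      | zero => exact hy
      | succ k ihk => rw [iterate_succ_apply']; exact hfwd _ ihk
    have := hk (p - 1)
    rwa [← iterate_succ_apply, Nat.succ_eq_add_one, Nat.sub_add_cancel hp.one_le, hσ] at this
  rw [← sum_sdiff hOF]
  refine add_mem (ih (F \ O) ?_ (fun y => ?_) fun y hy => ?_) ⟨h x, ?_⟩
  · exact sdiff_ssubset hOF ⟨x, hmemO 0⟩
  · simp [hF, hσO]
  · exact hfix y (mem_sdiff.1 hy).1
  · rw [endNorm_apply, hO, sum_image hinj]
    exact sum_congr rfl fun s _ => hit s x

/-- For a multilinear map in `p` variables, equivariant under cyclic rotation of the variables,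
the diagonal is additive modulo norms. -/
theorem diagonal_add_sub_mem_range_endNorm {V W : Type*} [AddCommGroup V] [AddCommGroup W]
    {p : ℕ} [NeZero p] (hp : p.Prime) (f : MultilinearMap ℤ (fun _ : Fin p => V) W)
    (S : Module.End ℤ W) (hS : ∀ v : Fin p → V, S (f v) = f fun k => v (k - 1)) (x y : V) :
    (f fun _ => x + y) - (f fun _ => x) - (f fun _ => y) ∈ LinearMap.range (endNorm S p) := by
  classical
  let h : (Fin p → Bool) → W := fun w => f fun k => bif w k then x else y
  have hsum : (f fun _ => x + y) = ∑ w, h w := by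
    have := f.map_sum (fun (_ : Fin p) (b : Bool) => bif b then x else y)
    simpa using this
  have hne : (fun _ : Fin p => true) ≠ fun _ => false := fun e => by
    simpa using congrFun e 0
  have hsplit : (f fun _ => x + y) - (f fun _ => x) - (f fun _ => y) =
      ∑ w ∈ univ \ {fun _ => true, fun _ => false}, h w := by
    have ht : h (fun _ => true) = f fun _ => x := rfl
    have hf : h (fun _ => false) = f fun _ => y := rfl
    rw [hsum, ← sum_sdiff (subset_univ {fun _ => true, fun _ => false}), sum_pair hne, ht, hf]
    abel
  have hconst : ∀ (w : Fin p → Bool), (∀ k, w (k - 1) = w k) → ∀ k, w k = w 0 := by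
    intro w hw
    have hn : ∀ m : ℕ, w (Fin.ofNat p m) = w 0 := by
      intro m
      induction m with
      | zero => congr 1
      | succ m ihm =>
        rw [← ihm, ← hw]
        congr 1
        rw [sub_eq_iff_eq_add]
        ext
        simp [Fin.val_add, Fin.ofNat]
    intro k
    rw [← hn k.1]
    congr 1
    ext
    simp [Fin.ofNat, Nat.mod_eq_of_lt k.2]
  rw [hsplit]
  refine sum_mem_range_endNorm S hp (fun w k => w (k - 1)) (fun w => ?_) h (fun w => hS _) _
    (fun w => ?_) fun w hw he => ?_
  · have hk : ∀ (m : ℕ) (w : Fin p → Bool),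
        (fun (w : Fin p → Bool) (k : Fin p) => w (k - 1))^[m] w = fun k => w (k - m • 1) := by
      intro m
      induction m with
      | zero => intro w; simp
      | succ m ihm =>
        intro w
        rw [iterate_succ_apply, ihm]
        funext k
        rw [succ_nsmul, sub_sub]
    rw [hk]
    funext k
    have : p • (1 : Fin p) = 0 := by
      simpa using card_nsmul_eq_zero (G := Fin p) (x := 1)
    rw [this, sub_zero]
  · have hc : ∀ b : Bool, ((fun k => w (k - 1)) = fun _ => b) ↔ w = fun _ => b := by
      refine fun b => ⟨fun e => funext fun k => ?_, fun e => by rw [e]⟩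
      simpa using congrFun e (k + 1)
    simp [hc]
  · have hw' := hconst w (congrFun he)
    simp only [mem_sdiff, mem_univ, true_and, mem_insert, mem_singleton, not_or] at hw
    cases hb : w 0
    · exact hw.2 (funext fun k => (hw' k).trans hb)
    · exact hw.1 (funext fun k => (hw' k).trans hb)

/-- A multilinear map which intertwines a diagonal action with an endomorphism preserves
congruence of invariant arguments modulo norms. -/
theorem multilinear_sub_mem_range_endNorm {ι V W : Type*} [Fintype ι]
    [AddCommGroup V] [AddCommGroup W] {p : ℕ} (f : MultilinearMap ℤ (fun _ : ι => V) W)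
    (σ : Module.End ℤ V) (S : Module.End ℤ W) (hS : ∀ v, S (f v) = f fun i => σ (v i))
    (a b : ι → V) (ha : ∀ i, σ (a i) = a i) (hb : ∀ i, σ (b i) = b i)
    (hab : ∀ i, a i - b i ∈ LinearMap.range (endNorm σ p)) :
    f a - f b ∈ LinearMap.range (endNorm S p) := by
  classical
  have hit : ∀ s v, S^[s] (f v) = f fun i => σ^[s] (v i) := by
    intro s
    induction s with
    | zero => intro v; rfl
    | succ s ih => intro v; simp only [iterate_succ_apply, hS, ih]
  suffices h : ∀ s : Finset ι, f (s.piecewise a b) - f b ∈ LinearMap.range (endNorm S p) by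
    simpa using h univ
  intro s
  induction s using Finset.induction_on with
  | empty => simp
  | insert i s hi ih =>
    set c := s.piecewise a b with hc
    have hci : c i = b i := by simp [hc, hi]
    have hcσ : ∀ j, σ (c j) = c j := by
      intro j
      by_cases hj : j ∈ s
      · simp [hc, hj, ha]
      · simp [hc, hj, hb]
    obtain ⟨y, hy⟩ := hab i
    have hstep : f ((insert i s).piecewise a b) - f c = endNorm S p (f (update c i y)) := by
      rw [piecewise_insert, ← hc]
      conv_lhs => rw [← update_eq_self i c, hci]
      rw [update_idem, ← f.map_update_sub, ← hy, endNorm_apply, endNorm_apply, f.map_update_sum]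
      refine sum_congr rfl fun k _ => ?_
      rw [hit]
      congr 1
      funext j
      by_cases hj : j = i
      · subst hj; simp
      · simp only [update_of_ne hj]
        exact (iterate_fixed (hcσ j) k).symm
    rw [← sub_add_sub_cancel _ (f c)]
    exact add_mem ⟨_, hstep.symm⟩ ih

end Norm

section Flatten

open PiTensorProduct

variable {A : Type*} [AddCommGroup A]

theorem mulEquiv_tmul_tprod {n m : ℕ} (a : Fin n → A) (b : Fin m → A) :
    TensorPower.mulEquiv (R := ℤ) (M := A) (tprod ℤ a ⊗ₜ[ℤ] tprod ℤ b) =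
      tprod ℤ (Fin.append a b) :=
  TensorPower.tprod_mul_tprod ℤ a b

theorem flattenE_tprod (N q : ℕ) (g : ℕ → ℕ → A) :
    flattenE A N q (tprod ℤ fun i : Fin q => tprod ℤ fun j : Fin N => g i j) =
      tprod ℤ fun k : Fin (N * q) => g (k / N) (k % N) := by
  induction q with
  | zero =>
    rw [flattenE, LinearEquiv.trans_apply, LinearEquiv.symm_apply_eq]
    simp only [isEmptyEquiv_apply_tprod]
  | succ q ih =>
    have hsplit : (tprod ℤ fun i : Fin (q + 1) => tprod ℤ fun j : Fin N => g i j) =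
        TensorPower.mulEquiv (R := ℤ) (M := Tp A N)
          ((tprod ℤ fun i : Fin q => tprod ℤ fun j : Fin N => g i j) ⊗ₜ[ℤ]
            (tprod ℤ fun _ : Fin 1 => tprod ℤ fun j : Fin N => g q j)) := by
      rw [mulEquiv_tmul_tprod]
      congr 1
      funext i
      refine Fin.addCases (fun i => ?_) (fun i => ?_) i
      · simp
      · simp
    rw [flattenE, LinearEquiv.trans_apply, LinearEquiv.trans_apply, hsplit,
      LinearEquiv.symm_apply_apply, TensorProduct.congr_tmul, ih, subsingletonEquiv_apply_tprod,
      mulEquiv_tmul_tprod]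
    congr 1
    funext k
    refine Fin.addCases (m := N * q) (n := N) (fun i => ?_) (fun i => ?_) k
    · simp
    · have hN : 0 < N := i.pos
      simp [Nat.mul_add_div hN, Nat.div_eq_of_lt i.2, Nat.mod_eq_of_lt i.2]

/-- Multilinear maps out of a family of tensor powers are determined by their values on
elementary tensors. -/
theorem multilinear_ext_tprod {W : Type*} [AddCommGroup W] {q N : ℕ}
    {f f' : MultilinearMap ℤ (fun _ : Fin q => Tp A N) W}
    (h : ∀ g : ℕ → ℕ → A, f (fun i => tprod ℤ fun j : Fin N => g i j) =
      f' (fun i => tprod ℤ fun j : Fin N => g i j)) : f = f' := by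
  classical
  have hu : ∀ u : Fin q → Fin N → A, f (fun i => tprod ℤ (u i)) = f' fun i => tprod ℤ (u i) := by
    intro u
    simpa using h fun i j => if hij : i < q ∧ j < N then u ⟨i, hij.1⟩ ⟨j, hij.2⟩ else 0
  suffices key : ∀ (s : Finset (Fin q)) (v : Fin q → Tp A N),
      (∀ i ∉ s, ∃ u, v i = PiTensorProduct.tprod ℤ u) → f v = f' v from
    MultilinearMap.ext fun v => key Finset.univ v (by simp)
  intro s
  induction s using Finset.induction_on with
  | empty =>
    intro v hv
    choose u hu' using fun i => hv i (by simp)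
    rw [funext hu', hu]
  | insert i s hi ih =>
    intro v hv
    have : ∀ z, f (Function.update v i z) = f' (Function.update v i z) := by
      intro z
      induction z using PiTensorProduct.induction_on with
      | smul_tprod r u =>
        rw [f.map_update_smul, f'.map_update_smul, ih]
        intro j hj
        by_cases hji : j = i
        · subst hji; exact ⟨u, by simp⟩
        · simpa [hji] using hv j (by simp [hji, hj])
      | add a b iha ihb => rw [f.map_update_add, f'.map_update_add, iha, ihb]
    simpa using this (v i)

theorem tcast_tprod {a b : ℕ} (h : a = b) (g : ℕ → A) :
    tcast (A := A) h (tprod ℤ fun k : Fin a => g k) = tprod ℤ fun k : Fin b => g k := by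
  subst h
  simp [tcast]

theorem permT_tprod {m : ℕ} (e : Equiv.Perm (Fin m)) (u v : Fin m → A)
    (h : ∀ k, v (e k) = u k) : permT A m e (tprod ℤ u) = tprod ℤ v := by
  rw [permT, reindex_tprod]
  congr 1
  funext k
  rw [← h, Equiv.apply_symm_apply]

end Flatten

section Digits

theorem Fin.val_sub_one_eq_mod {p : ℕ} [NeZero p] (k : Fin p) :
    ((k - 1 : Fin p) : ℕ) = (k + (p - 1)) % p := by
  obtain ⟨j, rfl⟩ : ∃ j, k = j + 1 := ⟨k - 1, by simp⟩
  rw [add_sub_cancel_right, Fin.val_add, Fin.val_one', Nat.add_mod_mod, Nat.mod_add_mod, add_assoc,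
    Nat.add_sub_cancel' (NeZero.pos p), Nat.add_mod_right, Nat.mod_eq_of_lt j.2]

theorem msbEquiv_val (p m : ℕ) (f : Fin m → Fin p) :
    (msbEquiv p m f : ℕ) = ∑ i : Fin m, (f i.rev : ℕ) * p ^ (i : ℕ) := by
  simp [msbEquiv]

theorem digitPerm_rotPerm_val (p n : ℕ) (k : Fin (p ^ (n + 1))) :
    (digitPerm p (n + 1) (rotPerm p (n + 1)) k : ℕ) = k / p + p ^ n * (k % p) := by
  obtain ⟨f, rfl⟩ := (msbEquiv p (n + 1)).surjective k
  have hrot : ∀ j, rotPerm p (n + 1) f j = f (j - 1) := fun j => by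
    simp [rotPerm, sub_eq_add_neg]
  have hp : 0 < p := (f 0).pos
  have hlow : (msbEquiv p (n + 1) f : ℕ) =
      f (Fin.last n) + p * ∑ i : Fin n, (f i.succ.rev : ℕ) * p ^ (i : ℕ) := by
    rw [msbEquiv_val, Fin.sum_univ_succ, Finset.mul_sum]
    congr 1
    · simp
    · refine Finset.sum_congr rfl fun i _ => ?_
      rw [Fin.val_succ, pow_succ]
      ring
  have hhigh : (msbEquiv p (n + 1) (rotPerm p (n + 1) f) : ℕ) =
      ∑ i : Fin n, (f i.succ.rev : ℕ) * p ^ (i : ℕ) + p ^ n * f (Fin.last n) := by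
    rw [msbEquiv_val, Fin.sum_univ_castSucc]
    congr 1
    · refine Finset.sum_congr rfl fun i _ => ?_
      rw [hrot, Fin.rev_castSucc, Fin.rev_succ, Fin.val_castSucc]
      congr 3
      rw [sub_eq_iff_eq_add, Fin.coeSucc_eq_succ]
    · rw [hrot, Fin.rev_last, Fin.val_last, mul_comm]
      congr 3
      rw [sub_eq_iff_eq_add, Fin.last_add_one]
  have hdp : digitPerm p (n + 1) (rotPerm p (n + 1)) (msbEquiv p (n + 1) f) =
      msbEquiv p (n + 1) (rotPerm p (n + 1) f) := by
    simp [digitPerm]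
  rw [hdp, hhigh, hlow, Nat.add_mul_div_left _ _ hp, Nat.div_eq_of_lt (f _).2, zero_add,
    Nat.add_mul_mod_self_left, Nat.mod_eq_of_lt (f _).2]

end Digits

section Rotation

open PiTensorProduct

variable {A : Type*} [AddCommGroup A]

theorem sigmaT_iterate_tprod {m : ℕ} [NeZero m] (t : ℕ) (u v : ℕ → A)
    (h : ∀ k < m, v ((k + t) % m) = u k) :
    (sigmaT A m)^[t] (tprod ℤ fun k : Fin m => u k) = tprod ℤ fun k : Fin m => v k := by
  have hit : ∀ (t : ℕ) (w : Fin m → A),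
      (sigmaT A m)^[t] (tprod ℤ w) = tprod ℤ fun k => w (k - t • 1) := by
    intro t
    induction t with
    | zero => intro w; simp
    | succ t ih =>
      intro w
      rw [Function.iterate_succ_apply, sigmaT,
        permT_tprod (Equiv.addRight 1) w (fun k => w (k - 1)) (by simp), ← sigmaT, ih]
      congr 1
      funext k
      rw [succ_nsmul, sub_sub]
  have hval : ∀ t : ℕ, ((t • (1 : Fin m) : Fin m) : ℕ) = t % m := by
    intro t
    induction t with
    | zero => simp
    | succ t ih => rw [succ_nsmul, Fin.val_add, ih, Fin.val_one']; simp
  rw [hit]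
  congr 1
  funext k
  obtain ⟨j, rfl⟩ : ∃ j, k = j + t • 1 := ⟨k - t • 1, by simp⟩
  rw [add_sub_cancel_right, ← h j j.2, Fin.val_add, hval, Nat.add_mod_mod]

/-- `σ^(p^n)` rotates the `p` consecutive blocks of length `p^n`. -/
theorem sigmaT_iterate_pow_tprod {p : ℕ} [NeZero p] (n : ℕ) (g : ℕ → ℕ → A) :
    (sigmaT A (p ^ (n + 1)))^[p ^ n]
        (tprod ℤ fun k : Fin (p ^ (n + 1)) => g (k / p ^ n) (k % p ^ n)) =
      tprod ℤ fun k : Fin (p ^ (n + 1)) => g ((k / p ^ n + (p - 1)) % p) (k % p ^ n) := by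
  have hp : 0 < p := NeZero.pos p
  have hq : 0 < p ^ n := pow_pos hp n
  refine sigmaT_iterate_tprod (p ^ n) (fun k => g (k / p ^ n) (k % p ^ n))
    (fun k => g ((k / p ^ n + (p - 1)) % p) (k % p ^ n)) fun k hk => ?_
  rw [pow_succ] at hk ⊢
  have hkp : k / p ^ n < p := Nat.div_lt_of_lt_mul hk
  have h1 : (k + p ^ n) % (p ^ n * p) / p ^ n = (k / p ^ n + 1) % p := by
    rw [Nat.mod_mul_right_div_self, Nat.add_div_right _ hq]
  have h2 : (k + p ^ n) % (p ^ n * p) % p ^ n = k % p ^ n := by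
    rw [Nat.mod_mul_right_mod, Nat.add_mod_right]
  have h3 : ((k / p ^ n + 1) % p + (p - 1)) % p = k / p ^ n := by
    rw [Nat.mod_add_mod, add_assoc, Nat.add_sub_cancel' hp, Nat.add_mod_right,
      Nat.mod_eq_of_lt hkp]
  simp only [h1, h2, h3]

end Rotation

noncomputable section Blocks

open PiTensorProduct

variable (p : ℕ) (M : Type*) [AddCommGroup M] (n : ℕ)

/-- The endomorphism `σ^(p^n)` of `M^{⊗p^(n+1)}`, generating the action of `C_p`. -/
def blockRot [NeZero p] : Module.End ℤ (Tp M (p ^ (n + 1))) :=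
  (sigmaT M (p ^ (n + 1))).toLinearMap ^ p ^ n

theorem blockRot_apply [NeZero p] (y : Tp M (p ^ (n + 1))) :
    blockRot p M n y = (sigmaT M (p ^ (n + 1)))^[p ^ n] y := by
  simp [blockRot, Module.End.pow_apply]

/-- Concatenation of `p` blocks of length `p^n`. -/
def concatBlocks : MultilinearMap ℤ (fun _ : Fin p => Tp M (p ^ n)) (Tp M (p ^ (n + 1))) :=
  ((tcast (A := M) (pow_succ p n).symm).toLinearMap ∘ₗ
    (flattenE M (p ^ n) p).toLinearMap).compMultilinearMap (tprod ℤ)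

/-- Interleaving of `p^n` tensors of length `p`: the `j`-th entry of the `i`-th tensor is placed
at the `i`-th position of the `j`-th block. -/
def interleave : MultilinearMap ℤ (fun _ : Fin (p ^ n) => Tp M p) (Tp M (p ^ (n + 1))) :=
  ((permT M (p ^ (n + 1)) (digitPerm p (n + 1) (rotPerm p (n + 1)))).toLinearMap ∘ₗ
    (tcast (A := M) (pow_succ' p n).symm).toLinearMap ∘ₗ
      (flattenE M p (p ^ n)).toLinearMap).compMultilinearMap (tprod ℤ)

variable {p M n}

theorem concatBlocks_tprod (g : ℕ → ℕ → M) :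
    concatBlocks p M n (fun j => tprod ℤ fun i : Fin (p ^ n) => g j i) =
      tprod ℤ fun k : Fin (p ^ (n + 1)) => g (k / p ^ n) (k % p ^ n) := by
  simp only [concatBlocks, LinearMap.compMultilinearMap_apply, LinearMap.comp_apply,
    LinearEquiv.coe_coe]
  rw [flattenE_tprod]
  exact tcast_tprod _ fun k => g (k / p ^ n) (k % p ^ n)

theorem interleave_tprod [NeZero p] (g : ℕ → ℕ → M) :
    interleave p M n (fun i => tprod ℤ fun j : Fin p => g i j) =
      tprod ℤ fun k : Fin (p ^ (n + 1)) => g (k % p ^ n) (k / p ^ n) := by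
  simp only [interleave, LinearMap.compMultilinearMap_apply, LinearMap.comp_apply,
    LinearEquiv.coe_coe]
  rw [flattenE_tprod, tcast_tprod _ fun k => g (k / p) (k % p)]
  refine permT_tprod _ _ _ fun k => ?_
  have hk : (k : ℕ) / p < p ^ n := Nat.div_lt_of_lt_mul (by rw [← pow_succ']; exact k.2)
  rw [digitPerm_rotPerm_val, Nat.add_mul_mod_self_left, Nat.mod_eq_of_lt hk,
    Nat.add_mul_div_left _ _ (pow_pos (NeZero.pos p) n), Nat.div_eq_of_lt hk, zero_add]

theorem blockRot_concatBlocks [NeZero p] (v : Fin p → Tp M (p ^ n)) :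
    blockRot p M n (concatBlocks p M n v) = concatBlocks p M n fun k => v (k - 1) := by
  suffices h : (blockRot p M n).compMultilinearMap (concatBlocks p M n) =
      (concatBlocks p M n).domDomCongr (Equiv.subRight 1) from
    congrArg (fun f => f v) h
  refine multilinear_ext_tprod fun g => ?_
  simp only [LinearMap.compMultilinearMap_apply, MultilinearMap.domDomCongr_apply,
    Equiv.subRight_apply, Fin.val_sub_one_eq_mod]
  rw [concatBlocks_tprod, blockRot_apply, sigmaT_iterate_pow_tprod,
    concatBlocks_tprod fun j i => g ((j + (p - 1)) % p) i]

theorem sigmaT_tprod [NeZero p] (u : Fin p → M) :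
    sigmaT M p (tprod ℤ u) = tprod ℤ fun k => u (k - 1) :=
  permT_tprod _ _ _ (by simp)

theorem blockRot_interleave [NeZero p] (v : Fin (p ^ n) → Tp M p) :
    blockRot p M n (interleave p M n v) = interleave p M n fun i => sigmaT M p (v i) := by
  suffices h : (blockRot p M n).compMultilinearMap (interleave p M n) =
      (interleave p M n).compLinearMap fun _ => (sigmaT M p).toLinearMap from
    congrArg (fun f => f v) h
  refine multilinear_ext_tprod fun g => ?_
  simp only [LinearMap.compMultilinearMap_apply, MultilinearMap.compLinearMap_apply,
    LinearEquiv.coe_coe, sigmaT_tprod, Fin.val_sub_one_eq_mod]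
  rw [interleave_tprod, blockRot_apply, sigmaT_iterate_pow_tprod n fun j i => g i j,
    interleave_tprod fun i j => g i ((j + (p - 1)) % p)]

theorem tpowTo_eq_concatBlocks (x : Tp M (p ^ n)) :
    tpowTo x p (pow_succ p n).symm = concatBlocks p M n fun _ => x :=
  rfl

theorem higherFrob_tprod (φ : M →+ Tp M p) (m : Fin (p ^ n) → M) :
    higherFrob p φ n (tprod ℤ m) = interleave p M n fun i => φ (m i) := by
  simp [higherFrob, frobT, interleave]

theorem concatBlocks_const_tprod [NeZero p] (m : Fin (p ^ n) → M) :
    (concatBlocks p M n fun _ => tprod ℤ m) =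
      interleave p M n fun i => tprod ℤ fun _ : Fin p => m i := by
  have h1 := concatBlocks_tprod (p := p) (n := n) fun _ i =>
    if h : i < p ^ n then m ⟨i, h⟩ else 0
  have h2 := interleave_tprod (p := p) (n := n) fun i _ =>
    if h : i < p ^ n then m ⟨i, h⟩ else 0
  rw [← h2] at h1
  simpa using h1

theorem higherFrob_tprod_sub_mem [NeZero p] (φ : ExternalFrobenius p M)
    (m : Fin (p ^ n) → M) :
    higherFrob p φ.toFun n (tprod ℤ m) - tpowTo (tprod ℤ m) p (pow_succ p n).symm ∈
      LinearMap.range (endNorm (blockRot p M n) p) := by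
  rw [tpowTo_eq_concatBlocks, higherFrob_tprod, concatBlocks_const_tprod]
  refine multilinear_sub_mem_range_endNorm (interleave p M n) (sigmaT M p).toLinearMap _
    blockRot_interleave _ _ (fun i => φ.fixed _) (fun i => sigmaT_tprod _) fun i => ?_
  obtain ⟨y, hy⟩ := φ.congr_pow (m i)
  exact ⟨y, by rw [← hy, endNorm_apply]; rfl⟩

end Blocks

/-- let `p` be a prime, `M` an abelian group with an external Frobenius `φ`,
and `n ≥ 1` (here written with `n ≥ 1` replaced by working at exponent `n + 1`).
Then for every `x ∈ M^{⊗p^n}`, the element `φ_n(x) − x^{⊗p}` of `M^{⊗p^{n+1}}` lies in the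
image of the transfer `tr_e^{C_p} = Σ_{s=0}^{p-1} σ_{n+1}^{s·p^n}`, the norm of the subgroup
`C_p ⊆ C_{p^{n+1}}` generated by `σ_{n+1}^{p^n}`. -/
theorem statement7 (p : ℕ) [NeZero p] (hp : p.Prime) (M : Type*) [AddCommGroup M]
    (φ : ExternalFrobenius p M) (n : ℕ) (x : Tp M (p ^ n)) :
    higherFrob p φ.toFun n x - tpowTo x p (pow_succ p n).symm
      ∈ Set.range (fun y : Tp M (p ^ (n + 1)) =>
          ∑ s ∈ Finset.range p, (⇑(sigmaT M (p ^ (n + 1))))^[s * p ^ n] y) := by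
  suffices h : higherFrob p φ.toFun n x - tpowTo x p (pow_succ p n).symm ∈
      LinearMap.range (endNorm (blockRot p M n) p) by
    obtain ⟨y, hy⟩ := h
    refine ⟨y, ?_⟩
    rw [← hy, endNorm_apply]
    refine Finset.sum_congr rfl fun s _ => ?_
    rw [mul_comm, Function.iterate_mul]
    congr 1
    exact funext fun z => (blockRot_apply p M n z).symm
  induction x using PiTensorProduct.induction_on with
  | smul_tprod r m =>
    have hr : r • PiTensorProduct.tprod ℤ m =
        PiTensorProduct.tprod ℤ (Function.update m 0 (r • m 0)) := by
      rw [MultilinearMap.map_update_smul, Function.update_eq_self]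
    rw [hr]
    exact higherFrob_tprod_sub_mem φ _
  | add x y hx hy =>
    have hadd := diagonal_add_sub_mem_range_endNorm hp (concatBlocks p M n) (blockRot p M n)
      blockRot_concatBlocks x y
    simp only [← tpowTo_eq_concatBlocks] at hadd
    convert sub_mem (add_mem hx hy) hadd using 1
    rw [map_add]
    abel
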